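/- arXiv:1510.02829 — 8 statements merged into one kernel-verified Lean document; each statement's English description precedes it below -/
import Mathlib

section
/- Let κ, η ∈ L be such that B(κ,κ) and B(η,η) are even integers. Set κ̃ = e₁ + (B(κ,κ)/2)·f₁ and η̃ = B(κ,η)·f₁ + e₂ + (B(η,η)/2)·f₂. Then B(κ̃,κ̃) = B(κ,κ), B(κ̃,η̃) = B(κ,η), B(η̃,η̃) = B(η,η), and the pair κ̃, η̃ induces a primitive embedding ℤ² ↪ L. -/
open scoped TensorProduct

/-- With `L`, `B`, `e₁, f₁, e₂, f₂` as before, if `κ, η ∈ L` have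
`B κ κ` and `B η η` even, then `κ̃ = e₁ + (B κ κ / 2) • f₁` and
`η̃ = B κ η • f₁ + e₂ + (B η η / 2) • f₂` satisfy `B κ̃ κ̃ = B κ κ`,
`B κ̃ η̃ = B κ η`, `B η̃ η̃ = B η η`, and the pair `κ̃, η̃` induces a primitive
embedding `ℤ² ↪ L`. -/
theorem stmt_2 (L : Type*) [AddCommGroup L] [Module.Free ℤ L] [Module.Finite ℤ L]
    (B : L →ₗ[ℤ] L →ₗ[ℤ] ℤ) (hB : ∀ x y : L, B x y = B y x)
    (e₁ f₁ e₂ f₂ : L)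
    (hee₁ : B e₁ e₁ = 0) (hee₁₂ : B e₁ e₂ = 0) (hee₂ : B e₂ e₂ = 0)
    (hff₁ : B f₁ f₁ = 0) (hff₁₂ : B f₁ f₂ = 0) (hff₂ : B f₂ f₂ = 0)
    (hef₁₁ : B e₁ f₁ = 1) (hef₁₂ : B e₁ f₂ = 0)
    (hef₂₁ : B e₂ f₁ = 0) (hef₂₂ : B e₂ f₂ = 1)
    (κ η : L) (hκeven : Even (B κ κ)) (hηeven : Even (B η η))
    (κt ηt : L)
    (hκt : κt = e₁ + (B κ κ / 2) • f₁)
    (hηt : ηt = (B κ η) • f₁ + e₂ + (B η η / 2) • f₂) :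
    B κt κt = B κ κ ∧ B κt ηt = B κ η ∧ B ηt ηt = B η η ∧
      (∀ a b : ℤ, a • κt + b • ηt = 0 → a = 0 ∧ b = 0) ∧
      ∀ x y : ℝ,
        (∃ w : L, x • ((1 : ℝ) ⊗ₜ[ℤ] κt) + y • ((1 : ℝ) ⊗ₜ[ℤ] ηt) = (1 : ℝ) ⊗ₜ[ℤ] w) →
          (∃ m : ℤ, (m : ℝ) = x) ∧ ∃ n : ℤ, (n : ℝ) = y := by
  have hfe₁₁ : B f₁ e₁ = 1 := by rw [hB, hef₁₁]
  have hfe₁₂ : B f₁ e₂ = 0 := by rw [hB, hef₂₁]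
  have hfe₂₁ : B f₂ e₁ = 0 := by rw [hB, hef₁₂]
  have hfe₂₂ : B f₂ e₂ = 1 := by rw [hB, hef₂₂]
  have hff₂₁ : B f₂ f₁ = 0 := by rw [hB, hff₁₂]
  have hee₂₁ : B e₂ e₁ = 0 := by rw [hB, hee₁₂]
  have h1κ : B f₁ κt = 1 := by simp [hκt, hfe₁₁, hff₁]
  have h1η : B f₁ ηt = 0 := by simp [hηt, hfe₁₂, hff₁, hff₁₂]
  have h2κ : B f₂ κt = 0 := by simp [hκt, hfe₂₁, hff₂₁]
  have h2η : B f₂ ηt = 1 := by simp [hηt, hfe₂₂, hff₂, hff₂₁]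
  refine ⟨?_, ?_, ?_, ?_, ?_⟩
  · obtain ⟨k, hk⟩ := hκeven
    simp only [hκt, map_add, map_smul, LinearMap.add_apply, LinearMap.smul_apply, smul_eq_mul,
      hee₁, hef₁₁, hfe₁₁, hff₁]
    omega
  · simp [hκt, hηt, hee₁₂, hef₁₁, hef₁₂, hfe₁₂, hff₁, hff₁₂]
  · obtain ⟨k, hk⟩ := hηeven
    simp only [hηt, map_add, map_smul, LinearMap.add_apply, LinearMap.smul_apply, smul_eq_mul,
      hee₂, hef₂₁, hef₂₂, hfe₁₂, hfe₂₂, hff₁, hff₁₂, hff₂, hff₂₁]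
    simp only [mul_zero, mul_one, add_zero, zero_add]
    omega
  · intro a b h
    have h1 := congrArg (B f₁) h
    have h2 := congrArg (B f₂) h
    simp only [map_add, map_smul, map_zero, smul_eq_mul, h1κ, h1η, h2κ, h2η] at h1 h2
    constructor <;> linarith
  · rintro x y ⟨w, hw⟩
    have key : ∀ f : L, x * (B f κt : ℝ) + y * (B f ηt : ℝ) = (B f w : ℝ) := by
      intro f
      have h := congrArg (fun t => TensorProduct.AlgebraTensorModule.rid ℤ ℝ ℝ
        ((B f).baseChange ℝ t)) hw
      simpa using h
    have h1 := key f₁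
    have h2 := key f₂
    simp only [h1κ, h1η, h2κ, h2η] at h1 h2
    push_cast at h1 h2
    exact ⟨⟨B f₁ w, by linarith⟩, ⟨B f₂ w, by linarith⟩⟩
end

section
/- Fix ℓ ∈ ℤ. For (z₁, z₂, u) ∈ ℂ² × ℂ the following are equivalent: (i) there exist γ ∈ ℤ⁴ and w ∈ ℤ such that a_γ(−z₁, −z₂, u + i·ℓ/2) = (z₁, z₂, u + i·w) (i.e. the point [z; u] of the quotient (ℂ² × (ℂ/iℤ))/ℤ⁴ is fixed by the involution [z; u] ↦ [−z; u + iℓ/2]); (ii) there exist integers n₁, m₁, n₂, m₂ with z₁ = (n₁ + i·m₁)/2, z₂ = (n₂ + i·m₂)/2, and k₁n₁m₁ + k₂n₂m₂ ≡ ℓ (mod 2). -/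
open Complex

/-- For `γ = (n₁, m₁, n₂, m₂) ∈ ℤ⁴` and fixed integers `k₁, k₂`, the affine map
`a_γ(z₁, z₂, u) = (z₁ + n₁ + i m₁, z₂ + n₂ + i m₂,
u − k₁(n₁z₁ + n₁²/2) − k₂(n₂z₂ + n₂²/2))` on `ℂ² × ℂ`. -/
noncomputable def latAct (k₁ k₂ : ℤ) (γ : ℤ × ℤ × ℤ × ℤ) (p : ℂ × ℂ × ℂ) : ℂ × ℂ × ℂ :=
  (p.1 + (γ.1 : ℂ) + Complex.I * (γ.2.1 : ℂ),
   p.2.1 + (γ.2.2.1 : ℂ) + Complex.I * (γ.2.2.2 : ℂ),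
   p.2.2 - (k₁ : ℂ) * ((γ.1 : ℂ) * p.1 + (γ.1 : ℂ) ^ 2 / 2)
        - (k₂ : ℂ) * ((γ.2.2.1 : ℂ) * p.2.1 + (γ.2.2.1 : ℂ) ^ 2 / 2))

/-- the point `[z;u]` of `(ℂ² × (ℂ/iℤ))/ℤ⁴` is fixed by the
involution `[z;u] ↦ [−z; u + iℓ/2]` (i.e. there are `γ ∈ ℤ⁴`, `w ∈ ℤ` with
`a_γ(−z₁, −z₂, u + iℓ/2) = (z₁, z₂, u + iw)`) if and only if there are
integers `n₁, m₁, n₂, m₂` with `z₁ = (n₁ + i m₁)/2`, `z₂ = (n₂ + i m₂)/2`,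
and `k₁n₁m₁ + k₂n₂m₂ ≡ ℓ (mod 2)`. -/
theorem stmt_9 (k₁ k₂ ℓ : ℤ) (z₁ z₂ u : ℂ) :
    (∃ (γ : ℤ × ℤ × ℤ × ℤ) (w : ℤ),
        latAct k₁ k₂ γ (-z₁, -z₂, u + Complex.I * (ℓ : ℂ) / 2) =
          (z₁, z₂, u + Complex.I * (w : ℂ))) ↔
      ∃ n₁ m₁ n₂ m₂ : ℤ,
        z₁ = ((n₁ : ℂ) + Complex.I * (m₁ : ℂ)) / 2 ∧
        z₂ = ((n₂ : ℂ) + Complex.I * (m₂ : ℂ)) / 2 ∧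
        k₁ * n₁ * m₁ + k₂ * n₂ * m₂ ≡ ℓ [ZMOD 2] := by
  constructor
  · rintro ⟨⟨n₁, m₁, n₂, m₂⟩, w, h⟩
    simp only [latAct, Prod.mk.injEq] at h
    obtain ⟨h1, h2, h3⟩ := h
    have e1 : z₁ = ((n₁ : ℂ) + Complex.I * (m₁ : ℂ)) / 2 := by linear_combination (-1/2) * h1
    have e2 : z₂ = ((n₂ : ℂ) + Complex.I * (m₂ : ℂ)) / 2 := by linear_combination (-1/2) * h2
    refine ⟨n₁, m₁, n₂, m₂, e1, e2, ?_⟩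
    rw [e1, e2] at h3
    have h4 : Complex.I * ((ℓ : ℂ) + (k₁ * n₁ * m₁ + k₂ * n₂ * m₂)) = Complex.I * (2 * w) := by
      linear_combination 2 * h3
    have h5 := mul_left_cancel₀ Complex.I_ne_zero h4
    have h6 : ℓ + (k₁ * n₁ * m₁ + k₂ * n₂ * m₂) = 2 * w := by exact_mod_cast h5
    rw [Int.modEq_iff_dvd]
    exact ⟨ℓ - w, by linarith⟩
  · rintro ⟨n₁, m₁, n₂, m₂, e1, e2, h⟩
    rw [Int.modEq_iff_dvd] at h
    obtain ⟨c, hc⟩ := h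
    have hc' : (ℓ : ℂ) - (k₁ * n₁ * m₁ + k₂ * n₂ * m₂) = 2 * c := by exact_mod_cast hc
    refine ⟨(n₁, m₁, n₂, m₂), ℓ - c, ?_⟩
    simp only [latAct, Prod.mk.injEq]
    refine ⟨?_, ?_, ?_⟩
    · rw [e1]; ring
    · rw [e2]; ring
    · rw [e1, e2]
      push_cast
      linear_combination (-Complex.I / 2) * hc'
end

section
/- Fix ℓ ∈ ℤ. If k₁ and k₂ are even and ℓ is odd, then for no (z₁, z₂, u) ∈ ℂ² × ℂ do there exist γ ∈ ℤ⁴ and w ∈ ℤ with a_γ(−z₁, −z₂, u + i·ℓ/2) = (z₁, z₂, u + i·w); i.e. the involution [z; u] ↦ [−z; u + iℓ/2] of the quotient (ℂ² × (ℂ/iℤ))/ℤ⁴ is free. -/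
open Complex

/-- if `k₁` and `k₂` are even and `ℓ` is odd, then for no
`(z₁, z₂, u) ∈ ℂ² × ℂ` do there exist `γ ∈ ℤ⁴` and `w ∈ ℤ` with
`a_γ(−z₁, −z₂, u + iℓ/2) = (z₁, z₂, u + iw)`; i.e. the involution
`[z;u] ↦ [−z; u + iℓ/2]` of `(ℂ² × (ℂ/iℤ))/ℤ⁴` is free. -/
theorem stmt_10 (k₁ k₂ ℓ : ℤ) (hk₁ : Even k₁) (hk₂ : Even k₂) (hℓ : Odd ℓ) :
    ∀ z₁ z₂ u : ℂ,
      ¬ ∃ (γ : ℤ × ℤ × ℤ × ℤ) (w : ℤ),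
          latAct k₁ k₂ γ (-z₁, -z₂, u + Complex.I * (ℓ : ℂ) / 2) =
            (z₁, z₂, u + Complex.I * (w : ℂ)) := by
  rintro z₁ z₂ u ⟨⟨n₁, m₁, n₂, m₂⟩, w, h⟩
  simp only [latAct, Prod.mk.injEq] at h
  obtain ⟨h1, h2, h3⟩ := h
  have e : Complex.I * ((ℓ + k₁ * n₁ * m₁ + k₂ * n₂ * m₂ : ℤ) : ℂ)
      = Complex.I * ((2 * w : ℤ) : ℂ) := by
    push_cast
    linear_combination 2 * h3 + (k₁ : ℂ) * n₁ * h1 + (k₂ : ℂ) * n₂ * h2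
  have e2 := mul_left_cancel₀ Complex.I_ne_zero e
  have e3 : ℓ + k₁ * n₁ * m₁ + k₂ * n₂ * m₂ = 2 * w := by exact_mod_cast e2
  have o : Odd (ℓ + k₁ * n₁ * m₁ + k₂ * n₂ * m₂) :=
    (hℓ.add_even ((hk₁.mul_right _).mul_right _)).add_even ((hk₂.mul_right _).mul_right _)
  rw [e3] at o
  exact (Int.not_odd_iff_even.mpr (even_two_mul w)) o
end

section
/- For all (n₁, m₁, n₂, m₂) ∈ ℤ⁴, all w ∈ ℂ, and all (z₁, z₂, u) ∈ ℂ² × ℂ: f(a^{(k₁,k₂)}_{(n₁,m₁,n₂,m₂)}(z₁, z₂, u)) = a^{(−k₁,−k₂)}_{(n₁,−m₁,n₂,−m₂)}(f(z₁, z₂, u)); f(z₁, z₂, u + w) = f(z₁, z₂, u) + (0, 0, w); and Ψ^{(−k₁,−k₂)}(f(z₁, z₂, u)) = Ψ^{(k₁,k₂)}(z₁, z₂, u). (Thus f descends to a ℂ^×-equivariant map M₊ → M₋ intertwining the moment maps.) -/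
open Complex

/-- The moment map `Ψ^{(k₁,k₂)}(z₁, z₂, u) = Re u + k₁ (Re z₁)²/2 + k₂ (Re z₂)²/2`. -/
noncomputable def momentPsi (k₁ k₂ : ℤ) (p : ℂ × ℂ × ℂ) : ℝ :=
  p.2.2.re + (k₁ : ℝ) * p.1.re ^ 2 / 2 + (k₂ : ℝ) * p.2.1.re ^ 2 / 2

/-- The map `f(z₁, z₂, u) = (z̄₁, z̄₂, u + k₁ (Re z₁)² + k₂ (Re z₂)²)`. -/
noncomputable def fMap (k₁ k₂ : ℤ) (p : ℂ × ℂ × ℂ) : ℂ × ℂ × ℂ :=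
  (starRingEnd ℂ p.1, starRingEnd ℂ p.2.1,
   p.2.2 + (((k₁ : ℝ) * p.1.re ^ 2 + (k₂ : ℝ) * p.2.1.re ^ 2 : ℝ) : ℂ))

/-- `f` intertwines `a^{(k₁,k₂)}_{(n₁,m₁,n₂,m₂)}` with
`a^{(−k₁,−k₂)}_{(n₁,−m₁,n₂,−m₂)}`, is equivariant for translations in the last
coordinate, and intertwines the moment maps `Ψ^{(k₁,k₂)}` and `Ψ^{(−k₁,−k₂)}`.
Thus `f` descends to a `ℂ^×`-equivariant map `M₊ → M₋` intertwining the moment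
maps. -/
theorem stmt_11 (k₁ k₂ : ℤ) :
    (∀ (γ : ℤ × ℤ × ℤ × ℤ) (p : ℂ × ℂ × ℂ),
        fMap k₁ k₂ (latAct k₁ k₂ γ p) =
          latAct (-k₁) (-k₂) (γ.1, -γ.2.1, γ.2.2.1, -γ.2.2.2) (fMap k₁ k₂ p)) ∧
    (∀ (w : ℂ) (p : ℂ × ℂ × ℂ),
        fMap k₁ k₂ (p.1, p.2.1, p.2.2 + w) = fMap k₁ k₂ p + (0, 0, w)) ∧
    (∀ p : ℂ × ℂ × ℂ, momentPsi (-k₁) (-k₂) (fMap k₁ k₂ p) = momentPsi k₁ k₂ p) := by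
  refine ⟨?_, ?_, ?_⟩
  · rintro ⟨n₁, m₁, n₂, m₂⟩ ⟨z₁, z₂, u⟩
    simp only [fMap, latAct, Prod.mk.injEq]
    refine ⟨?_, ?_, ?_⟩
    · simp
    · simp
    · push_cast
      simp only [Complex.re_eq_add_conj, map_add, map_mul, Complex.conj_I, map_intCast]
      ring
  · rintro w ⟨z₁, z₂, u⟩
    simp only [fMap, Prod.mk_add_mk, Prod.mk.injEq, add_zero, true_and]
    ring
  · rintro ⟨z₁, z₂, u⟩
    simp only [fMap, momentPsi, Complex.add_re, Complex.ofReal_re, Complex.conj_re]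
    push_cast
    ring
end

section
/- For all p = (z₁, z₂, u) ∈ ℂ³ and all v, w ∈ ℂ³: ω^{(−k₁,−k₂,k₃)}_{f(p)}(Df_p(v), Df_p(w)) = ω^{(k₁,k₂,k₃)}_p(v, w), where Df_p(v) = (conj(v₁), conj(v₂), v₃ + 2k₁·Re(z₁)·Re(v₁) + 2k₂·Re(z₂)·Re(v₂)) is the real derivative of f at p. (I.e. f pulls back the form ω^{(−k₁,−k₂,k₃)} to ω^{(k₁,k₂,k₃)}, so f is a symplectomorphism.) -/
open Complex

/-- For `p = (z₁, z₂, u)`, the `ℂ`-linear map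
`P_p(v) = (v₃ + k₁ Re(z₁) v₁ + k₂ Re(z₂) v₂)/2`. -/
noncomputable def Pform (k₁ k₂ : ℤ) (p v : ℂ × ℂ × ℂ) : ℂ :=
  (v.2.2 + (k₁ : ℂ) * (p.1.re : ℂ) * v.1 + (k₂ : ℂ) * (p.2.1.re : ℂ) * v.2.1) / 2

/-- The alternating 2-form
`ω_p(v,w) = k₃ Re(v₁w₂ − w₁v₂) − 4 Im(P_p(v) conj(P_p(w)))
 − Ψ(p)(k₁ Im(v₁ conj(w₁)) + k₂ Im(v₂ conj(w₂)))`, i.e. the form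
`ω̃ = k₃(dz₁dz₂ + dz̄₁dz̄₂)/2 + i∂∂̄(Ψ²)` of the paper in coordinates. -/
noncomputable def omegaForm (k₁ k₂ k₃ : ℤ) (p v w : ℂ × ℂ × ℂ) : ℝ :=
  (k₃ : ℝ) * (v.1 * w.2.1 - w.1 * v.2.1).re
    - 4 * (Pform k₁ k₂ p v * starRingEnd ℂ (Pform k₁ k₂ p w)).im
    - momentPsi k₁ k₂ p *
        ((k₁ : ℝ) * (v.1 * starRingEnd ℂ w.1).im + (k₂ : ℝ) * (v.2.1 * starRingEnd ℂ w.2.1).im)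

/-- The real derivative of `f` at `p = (z₁, z₂, u)`:
`Df_p(v) = (v̄₁, v̄₂, v₃ + 2k₁ Re(z₁) Re(v₁) + 2k₂ Re(z₂) Re(v₂))`. -/
noncomputable def DfMap (k₁ k₂ : ℤ) (p v : ℂ × ℂ × ℂ) : ℂ × ℂ × ℂ :=
  (starRingEnd ℂ v.1, starRingEnd ℂ v.2.1,
   v.2.2 + ((2 * (k₁ : ℝ) * p.1.re * v.1.re + 2 * (k₂ : ℝ) * p.2.1.re * v.2.1.re : ℝ) : ℂ))

theorem Pform_DfMap_aux (k₁ k₂ : ℤ) (p v : ℂ × ℂ × ℂ) :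
    Pform (-k₁) (-k₂) (fMap k₁ k₂ p) (DfMap k₁ k₂ p v) = Pform k₁ k₂ p v := by
  have h1 := Complex.add_conj v.1
  have h2 := Complex.add_conj v.2.1
  simp only [Pform, fMap, DfMap, Complex.conj_re]
  push_cast at *
  linear_combination (-(k₁ : ℂ) * p.1.re / 2) * h1 - ((k₂ : ℂ) * p.2.1.re / 2) * h2

theorem momentPsi_fMap_aux (k₁ k₂ : ℤ) (p : ℂ × ℂ × ℂ) :
    momentPsi (-k₁) (-k₂) (fMap k₁ k₂ p) = momentPsi k₁ k₂ p := by
  simp only [momentPsi, fMap, Complex.conj_re, Complex.add_re, Complex.ofReal_re]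
  push_cast
  ring

/-- `f` pulls back the form `ω^{(−k₁,−k₂,k₃)}` to
`ω^{(k₁,k₂,k₃)}`, i.e. `f` is a symplectomorphism. -/
theorem stmt_12 (k₁ k₂ k₃ : ℤ) (p v w : ℂ × ℂ × ℂ) :
    omegaForm (-k₁) (-k₂) k₃ (fMap k₁ k₂ p) (DfMap k₁ k₂ p v) (DfMap k₁ k₂ p w) =
      omegaForm k₁ k₂ k₃ p v w := by
  unfold omegaForm
  rw [Pform_DfMap_aux, Pform_DfMap_aux, momentPsi_fMap_aux]
  simp only [DfMap, Complex.sub_re, Complex.mul_re, Complex.mul_im, Complex.conj_re,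
    Complex.conj_im]
  push_cast
  ring
end

section
/- For every p = (z₁, z₂, u) ∈ ℂ³ and every v ∈ ℂ³, ω_p((0, 0, i), v) = −(Re(v₃) + k₁·Re(z₁)·Re(v₁) + k₂·Re(z₂)·Re(v₂)), which equals minus the Fréchet derivative of Ψ at p applied to v; i.e. Ψ is a moment map for the circle action generated by the vector field ξ = (0, 0, i). Moreover, ω_p((0, 0, i), (0, 0, −1)) = 1 > 0, i.e. ω(ξ, Jξ) > 0 everywhere, where J is multiplication by i. -/
open Complex

/-- contracting `ω` with the vector field `ξ = (0,0,i)` gives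
minus the Fréchet derivative of `Ψ`, i.e. `Ψ` is a moment map for the circle
action generated by `ξ`; moreover `ω_p(ξ, Jξ) = ω_p((0,0,i),(0,0,−1)) = 1 > 0`,
where `J` is multiplication by `i`. -/
theorem stmt_13 (k₁ k₂ k₃ : ℤ) (p : ℂ × ℂ × ℂ) :
    (∀ v : ℂ × ℂ × ℂ,
        omegaForm k₁ k₂ k₃ p (0, 0, Complex.I) v =
          -(v.2.2.re + (k₁ : ℝ) * p.1.re * v.1.re + (k₂ : ℝ) * p.2.1.re * v.2.1.re)) ∧
    (∃ D : (ℂ × ℂ × ℂ) →L[ℝ] ℝ, HasFDerivAt (momentPsi k₁ k₂) D p ∧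
        ∀ v : ℂ × ℂ × ℂ, omegaForm k₁ k₂ k₃ p (0, 0, Complex.I) v = -(D v)) ∧
    (omegaForm k₁ k₂ k₃ p (0, 0, Complex.I) (0, 0, -1) = 1 ∧
      (0 : ℝ) < omegaForm k₁ k₂ k₃ p (0, 0, Complex.I) (0, 0, -1)) := by
  have key : ∀ v : ℂ × ℂ × ℂ,
        omegaForm k₁ k₂ k₃ p (0, 0, Complex.I) v =
          -(v.2.2.re + (k₁ : ℝ) * p.1.re * v.1.re + (k₂ : ℝ) * p.2.1.re * v.2.1.re) := by
    intro v
    have h : ∀ w : ℂ, (Complex.I / 2 * starRingEnd ℂ (w / 2)).im = w.re / 4 := by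
      intro w
      have h2 : Complex.I / 2 * starRingEnd ℂ (w / 2) =
          ((1 / 4 : ℝ) : ℂ) * (Complex.I * starRingEnd ℂ w) := by
        rw [map_div₀, Complex.conj_ofNat]
        push_cast
        ring
      rw [h2, Complex.im_ofReal_mul]
      simp
      ring
    have h3 : Pform k₁ k₂ p (0, 0, Complex.I) = Complex.I / 2 := by simp [Pform]
    unfold omegaForm
    rw [h3]
    unfold Pform
    rw [h]
    simp
    ring
  have one : omegaForm k₁ k₂ k₃ p (0, 0, Complex.I) (0, 0, -1) = 1 := by
    rw [key]; simp
  refine ⟨key, ?_, one, by rw [one]; exact one_pos⟩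
  have a1 : HasFDerivAt (fun q : ℂ × ℂ × ℂ => q.1.re)
      (Complex.reCLM.comp (ContinuousLinearMap.fst ℝ ℂ (ℂ × ℂ))) p :=
    (Complex.reCLM.comp (ContinuousLinearMap.fst ℝ ℂ (ℂ × ℂ))).hasFDerivAt
  have a2 : HasFDerivAt (fun q : ℂ × ℂ × ℂ => q.2.1.re)
      (Complex.reCLM.comp ((ContinuousLinearMap.fst ℝ ℂ ℂ).comp
        (ContinuousLinearMap.snd ℝ ℂ (ℂ × ℂ)))) p :=
    (Complex.reCLM.comp ((ContinuousLinearMap.fst ℝ ℂ ℂ).comp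
        (ContinuousLinearMap.snd ℝ ℂ (ℂ × ℂ)))).hasFDerivAt
  have a3 : HasFDerivAt (fun q : ℂ × ℂ × ℂ => q.2.2.re)
      (Complex.reCLM.comp ((ContinuousLinearMap.snd ℝ ℂ ℂ).comp
        (ContinuousLinearMap.snd ℝ ℂ (ℂ × ℂ)))) p :=
    (Complex.reCLM.comp ((ContinuousLinearMap.snd ℝ ℂ ℂ).comp
        (ContinuousLinearMap.snd ℝ ℂ (ℂ × ℂ)))).hasFDerivAt
  have a := (a3.add ((a1.mul a1).const_mul ((k₁ : ℝ) / 2))).add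
    ((a2.mul a2).const_mul ((k₂ : ℝ) / 2))
  refine ⟨_, a.congr_of_eventuallyEq (Filter.Eventually.of_forall fun q => ?_), fun v => ?_⟩
  · simp [momentPsi]; ring
  · rw [key]; simp; ring
end

section
/- If k₃ ≠ 0 and k₁·k₂ > 0, then for every p ∈ ℂ³ the alternating bilinear form ω_p is nondegenerate on ℂ³ ≅ ℝ⁶: for every nonzero v ∈ ℂ³ there exists w ∈ ℂ³ with ω_p(v, w) ≠ 0. -/
open Complex

/-- if `k₃ ≠ 0` and `k₁k₂ > 0`, then for every `p` the
alternating form `ω_p` is nondegenerate on `ℂ³ ≅ ℝ⁶`: for every nonzero `v`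
there is `w` with `ω_p(v,w) ≠ 0`. -/
theorem stmt_14 (k₁ k₂ k₃ : ℤ) (hk₃ : k₃ ≠ 0) (hk : 0 < k₁ * k₂) (p : ℂ × ℂ × ℂ) :
    ∀ v : ℂ × ℂ × ℂ, v ≠ 0 → ∃ w : ℂ × ℂ × ℂ, omegaForm k₁ k₂ k₃ p v w ≠ 0 := by
  intro v hv
  by_contra hcon
  push Not at hcon
  apply hv
  have e1 := hcon (0, 0, 1)
  have e2 := hcon (0, 0, I * 2)
  have hP : Pform k₁ k₂ p v = 0 := by
    apply Complex.ext
    · have h : Pform k₁ k₂ p (0, 0, I * 2) = I := by simp [Pform]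
      simp only [omegaForm, h] at e2
      simp at e2
      simpa using e2
    · have h : Pform k₁ k₂ p (0, 0, 1) = 1 / 2 := by simp [Pform]
      simp only [omegaForm, h] at e1
      simp at e1
      simpa using e1
  have f1 := hcon (0, 1, 0)
  have f2 := hcon (0, I, 0)
  have f3 := hcon (1, 0, 0)
  have f4 := hcon (I, 0, 0)
  simp only [omegaForm, hP] at f1 f2 f3 f4
  simp at f1 f2 f3 f4
  generalize momentPsi k₁ k₂ p = Q at f1 f2 f3 f4
  have hk' : (0:ℝ) < k₁ * k₂ := by exact_mod_cast hk
  have hk₃' : (k₃:ℝ) ≠ 0 := by exact_mod_cast hk₃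
  have hpos : (0:ℝ) < k₃ ^ 2 + Q ^ 2 * (k₁ * k₂) := by positivity
  have key : ∀ x : ℝ, x * (k₃ ^ 2 + Q ^ 2 * (k₁ * k₂)) = 0 → x = 0 := fun x hx =>
    (mul_eq_zero.mp hx).resolve_right hpos.ne'
  have a0 : v.1.re = 0 := key _ (by linear_combination (k₃:ℝ) * f1 + Q * k₂ * f4)
  have b0 : v.1.im = 0 := key _ (by linear_combination -(k₃:ℝ) * f2 - Q * k₂ * f3)
  have c0 : v.2.1.re = 0 := key _ (by linear_combination -(k₃:ℝ) * f3 + Q * k₁ * f2)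
  have d0 : v.2.1.im = 0 := key _ (by linear_combination (k₃:ℝ) * f4 - Q * k₁ * f1)
  have h1 : v.1 = 0 := Complex.ext a0 b0
  have h2 : v.2.1 = 0 := Complex.ext c0 d0
  have h3 : v.2.2 = 0 := by simpa [Pform, h1, h2] using hP
  exact Prod.ext h1 (Prod.ext h2 h3)
end

section
/- For every p ∈ ℂ³ and every v ∈ ℂ³, ω_p(v, i·v) = 4·|P_p(v)|² + Ψ(p)·(k₁·|v₁|² + k₂·|v₂|²), where i·v denotes componentwise multiplication by i. Consequently, if k₁ > 0, k₂ > 0, and Ψ(p) > 0, then ω_p(v, i·v) > 0 for every nonzero v ∈ ℂ³; i.e. the standard complex structure of ℂ³ tames ω on the region {Ψ > 0}. -/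
open Complex

/-- `ω_p(v, i·v) = 4|P_p(v)|² + Ψ(p)(k₁|v₁|² + k₂|v₂|²)`,
where `i·v` is componentwise multiplication by `i`; consequently, if
`k₁ > 0`, `k₂ > 0`, and `Ψ(p) > 0`, then `ω_p(v, i·v) > 0` for every nonzero
`v`, i.e. the standard complex structure of `ℂ³` tames `ω` on `{Ψ > 0}`. -/
theorem stmt_15 (k₁ k₂ k₃ : ℤ) :
    (∀ (p v : ℂ × ℂ × ℂ),
        omegaForm k₁ k₂ k₃ p v (Complex.I * v.1, Complex.I * v.2.1, Complex.I * v.2.2) =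
          4 * Complex.normSq (Pform k₁ k₂ p v) +
            momentPsi k₁ k₂ p *
              ((k₁ : ℝ) * Complex.normSq v.1 + (k₂ : ℝ) * Complex.normSq v.2.1)) ∧
    (0 < k₁ → 0 < k₂ → ∀ p : ℂ × ℂ × ℂ, 0 < momentPsi k₁ k₂ p →
        ∀ v : ℂ × ℂ × ℂ, v ≠ 0 →
          0 < omegaForm k₁ k₂ k₃ p v
              (Complex.I * v.1, Complex.I * v.2.1, Complex.I * v.2.2)) := by
  have key : ∀ (p v : ℂ × ℂ × ℂ),
        omegaForm k₁ k₂ k₃ p v (Complex.I * v.1, Complex.I * v.2.1, Complex.I * v.2.2) =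
          4 * Complex.normSq (Pform k₁ k₂ p v) +
            momentPsi k₁ k₂ p *
              ((k₁ : ℝ) * Complex.normSq v.1 + (k₂ : ℝ) * Complex.normSq v.2.1) := by
    intro p v
    have hP : Pform k₁ k₂ p (Complex.I * v.1, Complex.I * v.2.1, Complex.I * v.2.2)
        = Complex.I * Pform k₁ k₂ p v := by
      simp only [Pform]; ring
    have hz : ∀ z : ℂ, (z * starRingEnd ℂ (Complex.I * z)).im = - Complex.normSq z := by
      intro z
      simp [Complex.normSq_apply]
    have h3 : v.1 * (Complex.I * v.2.1) - Complex.I * v.1 * v.2.1 = 0 := by ring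
    unfold omegaForm
    rw [hP, hz]
    simp only [hz, h3, Complex.zero_re]
    ring
  refine ⟨key, ?_⟩
  intro h1 h2 p hp v hv
  rw [key]
  have h1' : (0 : ℝ) < k₁ := by exact_mod_cast h1
  have h2' : (0 : ℝ) < k₂ := by exact_mod_cast h2
  have n0 := Complex.normSq_nonneg (Pform k₁ k₂ p v)
  have n1 := Complex.normSq_nonneg v.1
  have n2 := Complex.normSq_nonneg v.2.1
  by_cases a : v.1 = 0
  · by_cases b : v.2.1 = 0
    · have c : v.2.2 ≠ 0 := fun c => hv (Prod.ext a (Prod.ext b c))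
      have hP : Pform k₁ k₂ p v ≠ 0 := by
        simp [Pform, a, b, c]
      have := Complex.normSq_pos.2 hP
      positivity
    · have := Complex.normSq_pos.2 b
      positivity
  · have := Complex.normSq_pos.2 a
    positivity
end
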